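/- Let n ≥ 3. Let 𝒲 = {x : Fin n → ℂP¹ | x is injective}, with the subspace topology of the product topology, and let GL (Fin 2) ℂ act on 𝒲 by (g • x) i = g • (x i). Then the quotient space 𝒲 / (orbit equivalence of this action), with the quotient topology, is homeomorphic to the subspace {y : Fin (n−3) → ℂP¹ | y is injective and for every i, y i ∉ {(1:0), (0:1), (1:1)}} of the product (ℂP¹)^{n−3}. (The space of parameters of the main stratum of G_{n,2} is homeomorphic to (ℂP¹)^{n−3} minus the sets where some coordinate lies in A = {(1:0),(0:1),(1:1)} and the pairwise diagonals.) -/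

import Mathlib

open scoped LinearAlgebra.Projectivization

/-- The quotient topology on the complex projective line. -/
noncomputable instance : TopologicalSpace (ℙ ℂ (Fin 2 → ℂ)) := instTopologicalSpaceQuotient

/-- The point of the complex projective line with homogeneous coordinates `(a : b)`. -/
noncomputable def pt (a b : ℂ) (h : a ≠ 0 ∨ b ≠ 0) : ℙ ℂ (Fin 2 → ℂ) :=
  Projectivization.mk ℂ ![a, b] (fun hz => by
    rcases h with h | h
    · exact h (by simpa using congrFun hz 0)
    · exact h (by simpa using congrFun hz 1))

/-- The action of `GL(2, ℂ)` on the complex projective line `ℂP¹`,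
given on homogeneous coordinates by `g • [v] = [g v]`. -/
noncomputable def glSMul (g : GL (Fin 2) ℂ) (x : ℙ ℂ (Fin 2 → ℂ)) : ℙ ℂ (Fin 2 → ℂ) :=
  Projectivization.map (Matrix.mulVecLin (g : Matrix (Fin 2) (Fin 2) ℂ))
    (fun v w h => by
      have h3 : ((↑g : Matrix (Fin 2) (Fin 2) ℂ))⁻¹ * (↑g : Matrix (Fin 2) (Fin 2) ℂ) = 1 := by
        rw [← Matrix.coe_units_inv, ← Units.val_mul, inv_mul_cancel, Units.val_one]
      have h2 := congrArg (Matrix.mulVecLin (((↑g : Matrix (Fin 2) (Fin 2) ℂ))⁻¹)) h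
      simpa only [Matrix.mulVecLin_apply, Matrix.mulVec_mulVec, h3, Matrix.one_mulVec] using h2) x

open scoped Matrix

/-- The determinant of a pair of vectors of `ℂ²`. -/
def wedge (u v : Fin 2 → ℂ) : ℂ := u 0 * v 1 - u 1 * v 0

/-- Homogeneous coordinates of the cross ratio of four vectors: the image of `z` under a linear map
sending the lines of `u`, `v`, `w` to `(1 : 0)`, `(0 : 1)`, `(1 : 1)`. -/
def crossVec (u v w z : Fin 2 → ℂ) : Fin 2 → ℂ :=
  ![wedge z v * wedge w u, wedge z u * wedge w v]

/-- The matrix of the linear map `crossVec u v w`. -/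
def crossMatrix (u v w : Fin 2 → ℂ) : Matrix (Fin 2) (Fin 2) ℂ :=
  !![v 1 * wedge w u, -(v 0 * wedge w u); u 1 * wedge w v, -(u 0 * wedge w v)]

lemma crossMatrix_mulVec (u v w z : Fin 2 → ℂ) :
    crossMatrix u v w *ᵥ z = crossVec u v w z := by
  ext i
  fin_cases i <;> simp [crossMatrix, crossVec, Matrix.mulVec, dotProduct, Fin.sum_univ_two, wedge]
    <;> ring

lemma det_crossMatrix (u v w : Fin 2 → ℂ) :
    (crossMatrix u v w).det = -(wedge u v * wedge w u * wedge w v) := by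
  simp [crossMatrix, Matrix.det_fin_two, wedge]
  ring

lemma wedge_mulVec (g : Matrix (Fin 2) (Fin 2) ℂ) (u v : Fin 2 → ℂ) :
    wedge (g *ᵥ u) (g *ᵥ v) = g.det * wedge u v := by
  simp [wedge, Matrix.det_fin_two, Matrix.mulVec, dotProduct, Fin.sum_univ_two]
  ring

lemma crossVec_mulVec (g : Matrix (Fin 2) (Fin 2) ℂ) (u v w z : Fin 2 → ℂ) :
    crossVec (g *ᵥ u) (g *ᵥ v) (g *ᵥ w) (g *ᵥ z) = g.det ^ 2 • crossVec u v w z := by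
  ext i
  fin_cases i <;> simp only [crossVec, wedge_mulVec] <;> simp <;> ring

lemma crossVec_smul (a b c : ℂ) (u v w z : Fin 2 → ℂ) :
    crossVec (a • u) (b • v) (c • w) z = (a * b * c) • crossVec u v w z := by
  ext i
  fin_cases i <;> simp [crossVec, wedge] <;> ring

lemma mk_eq_mk_iff_wedge {u v : Fin 2 → ℂ} (hu : u ≠ 0) (hv : v ≠ 0) :
    Projectivization.mk ℂ u hu = Projectivization.mk ℂ v hv ↔ wedge u v = 0 := by
  rw [Projectivization.mk_eq_mk_iff']
  constructor
  · rintro ⟨a, rfl⟩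
    simp [wedge]
    ring
  · intro h
    unfold wedge at h
    by_cases h0 : v 0 = 0
    · have h1 : v 1 ≠ 0 := fun h1 => hv (by ext i; fin_cases i <;> simp [h0, h1])
      refine ⟨u 1 / v 1, ?_⟩
      have hu0 : u 0 = 0 := by simpa [h0, h1] using h
      ext i
      fin_cases i <;> simp [h0, h1, hu0]
    · refine ⟨u 0 / v 0, ?_⟩
      ext i
      fin_cases i
      · simp [h0]
      · simp only [Fin.mk_one, Pi.smul_apply, smul_eq_mul]
        field_simp
        linear_combination h

lemma crossVec_ne_zero {u v w z : Fin 2 → ℂ} (huv : wedge u v ≠ 0) (hwu : wedge w u ≠ 0)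
    (hwv : wedge w v ≠ 0) (hz : z ≠ 0) : crossVec u v w z ≠ 0 := by
  rw [← crossMatrix_mulVec]
  intro h
  refine hz (Matrix.eq_zero_of_mulVec_eq_zero ?_ h)
  simp [det_crossMatrix, huv, hwu, hwv]

lemma wedge_rep_ne_zero {p q : ℙ ℂ (Fin 2 → ℂ)} (h : p ≠ q) : wedge p.rep q.rep ≠ 0 := by
  rwa [Ne, ← mk_eq_mk_iff_wedge p.rep_nonzero q.rep_nonzero, p.mk_rep, q.mk_rep]

/-- An element of `GL(2, ℂ)` sending three distinct points `p`, `q`, `r` to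
`(1 : 0)`, `(0 : 1)`, `(1 : 1)`. -/
noncomputable def normalizer3 (p q r : ℙ ℂ (Fin 2 → ℂ)) (hpq : p ≠ q) (hrp : r ≠ p)
    (hrq : r ≠ q) : GL (Fin 2) ℂ :=
  Matrix.GeneralLinearGroup.mkOfDetNeZero (crossMatrix p.rep q.rep r.rep) (by
    simp [det_crossMatrix, wedge_rep_ne_zero hpq, wedge_rep_ne_zero hrp, wedge_rep_ne_zero hrq])

lemma mulVec_GL_ne_zero (g : GL (Fin 2) ℂ) {v : Fin 2 → ℂ} (hv : v ≠ 0) :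
    (g : Matrix (Fin 2) (Fin 2) ℂ) *ᵥ v ≠ 0 :=
  fun h => hv (Matrix.eq_zero_of_mulVec_eq_zero g.det_ne_zero h)

lemma glSMul_mk (g : GL (Fin 2) ℂ) (v : Fin 2 → ℂ) (hv : v ≠ 0) :
    glSMul g (Projectivization.mk ℂ v hv) =
      Projectivization.mk ℂ ((g : Matrix (Fin 2) (Fin 2) ℂ) *ᵥ v) (mulVec_GL_ne_zero g hv) :=
  rfl

lemma glSMul_injective (g : GL (Fin 2) ℂ) : Function.Injective (glSMul g) :=
  Projectivization.map_injective (Matrix.mulVecLin (g : Matrix (Fin 2) (Fin 2) ℂ))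
    (Matrix.mulVec_injective_of_isUnit g.isUnit)

lemma glSMul_normalizer3 {p q r : ℙ ℂ (Fin 2 → ℂ)} (hpq : p ≠ q) (hrp : r ≠ p) (hrq : r ≠ q)
    {u v w z : Fin 2 → ℂ} (hu : u ≠ 0) (hv : v ≠ 0) (hw : w ≠ 0) (hz : z ≠ 0)
    (hp : Projectivization.mk ℂ u hu = p) (hq : Projectivization.mk ℂ v hv = q)
    (hr : Projectivization.mk ℂ w hw = r) (hne : crossVec u v w z ≠ 0) :
    glSMul (normalizer3 p q r hpq hrp hrq) (Projectivization.mk ℂ z hz) =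
      Projectivization.mk ℂ (crossVec u v w z) hne := by
  subst hp hq hr
  obtain ⟨a, ha⟩ := Projectivization.exists_smul_eq_mk_rep ℂ u hu
  obtain ⟨b, hb⟩ := Projectivization.exists_smul_eq_mk_rep ℂ v hv
  obtain ⟨c, hc⟩ := Projectivization.exists_smul_eq_mk_rep ℂ w hw
  rw [glSMul_mk, Projectivization.mk_eq_mk_iff']
  refine ⟨a * b * c, ?_⟩
  rw [← crossVec_smul]
  change _ = crossMatrix _ _ _ *ᵥ z
  rw [crossMatrix_mulVec, ← ha, ← hb, ← hc]
  rfl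

lemma glSMul_normalizer3_points {p q r : ℙ ℂ (Fin 2 → ℂ)} (hpq : p ≠ q) (hrp : r ≠ p)
    (hrq : r ≠ q) :
    glSMul (normalizer3 p q r hpq hrp hrq) p = pt 1 0 (Or.inl one_ne_zero) ∧
    glSMul (normalizer3 p q r hpq hrp hrq) q = pt 0 1 (Or.inr one_ne_zero) ∧
    glSMul (normalizer3 p q r hpq hrp hrq) r = pt 1 1 (Or.inl one_ne_zero) := by
  have key : ∀ s : ℙ ℂ (Fin 2 → ℂ), glSMul (normalizer3 p q r hpq hrp hrq) s =
      Projectivization.mk ℂ (crossVec p.rep q.rep r.rep s.rep)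
        (crossVec_ne_zero (wedge_rep_ne_zero hpq) (wedge_rep_ne_zero hrp)
          (wedge_rep_ne_zero hrq) s.rep_nonzero) := fun s => by
    conv_lhs => rw [← s.mk_rep]
    exact glSMul_normalizer3 hpq hrp hrq p.rep_nonzero q.rep_nonzero r.rep_nonzero _
      p.mk_rep q.mk_rep r.mk_rep _
  refine ⟨?_, ?_, ?_⟩ <;> rw [key, pt, mk_eq_mk_iff_wedge] <;> simp [wedge, crossVec]
  · exact Or.inl (by ring)
  · exact Or.inl (by ring)
  · ring

lemma glSMul_normalizer3_standard (h₁ h₂ h₃) (z : ℙ ℂ (Fin 2 → ℂ)) :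
    glSMul (normalizer3 (pt 1 0 (Or.inl one_ne_zero)) (pt 0 1 (Or.inr one_ne_zero))
      (pt 1 1 (Or.inl one_ne_zero)) h₁ h₂ h₃) z = z := by
  induction z using Projectivization.ind with | h z hz =>
  have hcross : crossVec ![1, 0] ![0, 1] ![1, 1] z = -z := by
    ext i
    fin_cases i <;> simp [crossVec, wedge]
  rw [glSMul_normalizer3 h₁ h₂ h₃ _ _ _ hz rfl rfl rfl (by rw [hcross]; exact neg_ne_zero.2 hz),
    Projectivization.mk_eq_mk_iff']
  exact ⟨-1, by simp [hcross]⟩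

lemma glSMul_normalizer3_glSMul (g : GL (Fin 2) ℂ) (p q r s : ℙ ℂ (Fin 2 → ℂ))
    (hpq hrp hrq hpq' hrp' hrq') :
    glSMul (normalizer3 (glSMul g p) (glSMul g q) (glSMul g r) hpq' hrp' hrq') (glSMul g s) =
      glSMul (normalizer3 p q r hpq hrp hrq) s := by
  have hg : (g : Matrix (Fin 2) (Fin 2) ℂ).det ≠ 0 := g.det_ne_zero
  induction p using Projectivization.ind with | h u hu =>
  induction q using Projectivization.ind with | h v hv =>
  induction r using Projectivization.ind with | h w hw =>
  induction s using Projectivization.ind with | h z hz =>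
  have hne : crossVec u v w z ≠ 0 := by
    rw [Ne, mk_eq_mk_iff_wedge] at hpq hrp hrq
    exact crossVec_ne_zero hpq hrp hrq hz
  rw [glSMul_normalizer3 hpq hrp hrq hu hv hw hz rfl rfl rfl hne, glSMul_mk g z,
    glSMul_normalizer3 hpq' hrp' hrq' (mulVec_GL_ne_zero g hu) (mulVec_GL_ne_zero g hv)
      (mulVec_GL_ne_zero g hw) _ rfl rfl rfl
      (by rw [crossVec_mulVec]; exact smul_ne_zero (pow_ne_zero 2 hg) hne),
    Projectivization.mk_eq_mk_iff']
  exact ⟨_, (crossVec_mulVec _ _ _ _ _).symm⟩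

lemma continuous_projectivization_mk' :
    Continuous (Projectivization.mk' ℂ : {v : Fin 2 → ℂ // v ≠ 0} → ℙ ℂ (Fin 2 → ℂ)) :=
  continuous_quot_mk

lemma isOpenQuotientMap_projectivization_mk' :
    IsOpenQuotientMap (Projectivization.mk' ℂ : {v : Fin 2 → ℂ // v ≠ 0} → ℙ ℂ (Fin 2 → ℂ)) := by
  refine ⟨Quot.mk_surjective, continuous_projectivization_mk', fun U hU => ?_⟩
  have hset : Projectivization.mk' ℂ ⁻¹' (Projectivization.mk' ℂ '' U) =
      ⋃ a : ℂˣ, (fun v : {v : Fin 2 → ℂ // v ≠ 0} =>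
        (⟨a • v.1, (smul_ne_zero_iff_ne a).2 v.2⟩ : {v : Fin 2 → ℂ // v ≠ 0})) ⁻¹' U := by
    ext v
    simp only [Set.mem_preimage, Set.mem_image, Set.mem_iUnion, Projectivization.mk'_eq_mk,
      Projectivization.mk_eq_mk_iff]
    constructor
    · rintro ⟨w, hw, a, ha⟩
      exact ⟨a, by simpa only [ha] using hw⟩
    · rintro ⟨a, ha⟩
      exact ⟨_, ha, a, rfl⟩
  change IsOpen (Projectivization.mk' ℂ ⁻¹' (Projectivization.mk' ℂ '' U))
  rw [hset]
  exact isOpen_iUnion fun a => hU.preimage (by fun_prop)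

/-- The normalized tuple of a configuration: apply the projective transformation that sends the
first three points to `(1 : 0)`, `(0 : 1)`, `(1 : 1)` and keep the remaining points. -/
noncomputable def normalizeConfiguration {m : ℕ} (x : Fin (m + 3) → ℙ ℂ (Fin 2 → ℂ))
    (hx : Function.Injective x) (i : Fin m) : ℙ ℂ (Fin 2 → ℂ) :=
  glSMul (normalizer3 (x 0) (x (Fin.succ 0)) (x (Fin.succ (Fin.succ 0)))
    (hx.ne ((Fin.succ_ne_zero _).symm)) (hx.ne (Fin.succ_ne_zero _))
    (hx.ne ((Fin.succ_injective _).ne (Fin.succ_ne_zero _)))) (x i.succ.succ.succ)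

lemma continuous_normalizeConfiguration (m : ℕ) :
    Continuous fun x : {x : Fin (m + 3) → ℙ ℂ (Fin 2 → ℂ) // Function.Injective x} =>
      normalizeConfiguration x.1 x.2 := by
  have hquot := (IsOpenQuotientMap.piMap fun _ : Fin (m + 3) =>
    isOpenQuotientMap_projectivization_mk').restrictPreimage {x | Function.Injective x}
  refine hquot.continuous_comp_iff.1 (continuous_pi fun i => ?_)
  have hne (t : Pi.map (fun _ : Fin (m + 3) =>
        (Projectivization.mk' ℂ : {v : Fin 2 → ℂ // v ≠ 0} → ℙ ℂ (Fin 2 → ℂ))) ⁻¹'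
        {x | Function.Injective x}) {j k : Fin (m + 3)} (hjk : j ≠ k) :
      wedge (t.1 j).1 (t.1 k).1 ≠ 0 := by
    rw [Ne, ← mk_eq_mk_iff_wedge (t.1 j).2 (t.1 k).2]
    exact fun h => hjk (t.2 h)
  have hcross (t : Pi.map (fun _ : Fin (m + 3) =>
        (Projectivization.mk' ℂ : {v : Fin 2 → ℂ // v ≠ 0} → ℙ ℂ (Fin 2 → ℂ))) ⁻¹'
        {x | Function.Injective x}) :
      crossVec (t.1 0).1 (t.1 (Fin.succ 0)).1 (t.1 (Fin.succ (Fin.succ 0))).1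
        (t.1 i.succ.succ.succ).1 ≠ 0 :=
    crossVec_ne_zero (hne t ((Fin.succ_ne_zero _).symm)) (hne t (Fin.succ_ne_zero _))
      (hne t ((Fin.succ_injective _).ne (Fin.succ_ne_zero _))) (t.1 _).2
  refine (continuous_projectivization_mk'.comp
    (Continuous.subtype_mk (f := fun t => crossVec (t.1 0).1 (t.1 (Fin.succ 0)).1
      (t.1 (Fin.succ (Fin.succ 0))).1 (t.1 i.succ.succ.succ).1) ?_ hcross)).congr fun t => ?_
  · have hcoord (j : Fin (m + 3)) (k : Fin 2) : Continuous fun t : Pi.map (fun _ : Fin (m + 3) =>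
        (Projectivization.mk' ℂ : {v : Fin 2 → ℂ // v ≠ 0} → ℙ ℂ (Fin 2 → ℂ))) ⁻¹'
        {x | Function.Injective x} => (t.1 j).1 k :=
      (continuous_apply k).comp <| continuous_subtype_val.comp <|
        (continuous_apply j).comp continuous_subtype_val
    have hwedge (j k : Fin (m + 3)) := ((hcoord j 0).mul (hcoord k 1)).sub
      ((hcoord j 1).mul (hcoord k 0))
    refine continuous_pi fun k => ?_
    fin_cases k
    · exact (hwedge _ _).mul (hwedge _ _)
    · exact (hwedge _ _).mul (hwedge _ _)
  · exact (glSMul_normalizer3 _ _ _ (t.1 _).2 (t.1 _).2 (t.1 _).2 (t.1 _).2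
      rfl rfl rfl (hcross t)).symm

lemma normalizeConfiguration_injective {m : ℕ} {x : Fin (m + 3) → ℙ ℂ (Fin 2 → ℂ)}
    (hx : Function.Injective x) : Function.Injective (normalizeConfiguration x hx) :=
  (glSMul_injective _).comp <| hx.comp <|
    (Fin.succ_injective _).comp <| (Fin.succ_injective _).comp (Fin.succ_injective _)

lemma normalizeConfiguration_notMem {m : ℕ} {x : Fin (m + 3) → ℙ ℂ (Fin 2 → ℂ)}
    (hx : Function.Injective x) (i : Fin m) :
    normalizeConfiguration x hx i ∉ ({pt 1 0 (Or.inl one_ne_zero), pt 0 1 (Or.inr one_ne_zero),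
      pt 1 1 (Or.inl one_ne_zero)} : Set (ℙ ℂ (Fin 2 → ℂ))) := by
  obtain ⟨h0, h1, h2⟩ := glSMul_normalizer3_points (p := x 0) (q := x (Fin.succ 0))
    (r := x (Fin.succ (Fin.succ 0))) (hx.ne ((Fin.succ_ne_zero _).symm))
    (hx.ne (Fin.succ_ne_zero _)) (hx.ne ((Fin.succ_injective _).ne (Fin.succ_ne_zero _)))
  rw [normalizeConfiguration, ← h0, ← h1, ← h2]
  simp only [Set.mem_insert_iff, Set.mem_singleton_iff, (glSMul_injective _).eq_iff, hx.eq_iff,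
    Fin.succ_inj, Fin.succ_ne_zero, or_self, not_false_eq_true]

lemma normalizeConfiguration_eq_of_glSMul {m : ℕ} {x y : Fin (m + 3) → ℙ ℂ (Fin 2 → ℂ)}
    (hx : Function.Injective x) (hy : Function.Injective y) {g : GL (Fin 2) ℂ}
    (h : ∀ i, glSMul g (x i) = y i) :
    normalizeConfiguration x hx = normalizeConfiguration y hy := by
  obtain rfl : (fun i => glSMul g (x i)) = y := funext h
  exact funext fun i => (glSMul_normalizer3_glSMul g _ _ _ _ _ _ _ _ _ _).symm

/-- Prepend the points `(1 : 0)`, `(0 : 1)`, `(1 : 1)` to a tuple of points. -/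
noncomputable def standardExtend {m : ℕ} (y : Fin m → ℙ ℂ (Fin 2 → ℂ)) :
    Fin (m + 3) → ℙ ℂ (Fin 2 → ℂ) :=
  Fin.cons (pt 1 0 (Or.inl one_ne_zero)) <| Fin.cons (pt 0 1 (Or.inr one_ne_zero)) <|
    Fin.cons (pt 1 1 (Or.inl one_ne_zero)) y

lemma continuous_standardExtend (m : ℕ) : Continuous (standardExtend (m := m)) := by
  refine continuous_pi fun i => ?_
  unfold standardExtend
  refine Fin.cases ?_ (fun i => Fin.cases ?_ (fun i => Fin.cases ?_ (fun i => ?_) i) i) i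
  all_goals simp only [Fin.cons_zero, Fin.cons_succ]; fun_prop

lemma standardExtend_injective {m : ℕ} {y : Fin m → ℙ ℂ (Fin 2 → ℂ)} (hy : Function.Injective y)
    (hmem : ∀ i, y i ∉ ({pt 1 0 (Or.inl one_ne_zero), pt 0 1 (Or.inr one_ne_zero),
      pt 1 1 (Or.inl one_ne_zero)} : Set (ℙ ℂ (Fin 2 → ℂ)))) :
    Function.Injective (standardExtend y) := by
  simp only [Set.mem_insert_iff, Set.mem_singleton_iff, not_or] at hmem
  simp only [standardExtend, Fin.cons_injective_iff, Set.mem_range, not_exists]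
  refine ⟨Fin.cases ?_ (Fin.cases ?_ fun i => (hmem i).1), Fin.cases ?_ fun i => (hmem i).2.1,
    fun i => (hmem i).2.2, hy⟩
  all_goals simp [pt, mk_eq_mk_iff_wedge, wedge]

lemma normalizeConfiguration_standardExtend {m : ℕ} (y : Fin m → ℙ ℂ (Fin 2 → ℂ))
    (h : Function.Injective (standardExtend y)) :
    normalizeConfiguration (standardExtend y) h = y :=
  funext fun _ => glSMul_normalizer3_standard _ _ _ _

lemma exists_glSMul_eq_standardExtend {m : ℕ} {x : Fin (m + 3) → ℙ ℂ (Fin 2 → ℂ)}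
    (hx : Function.Injective x) :
    ∃ g, ∀ i, glSMul g (x i) = standardExtend (normalizeConfiguration x hx) i := by
  obtain ⟨h0, h1, h2⟩ := glSMul_normalizer3_points (p := x 0) (q := x (Fin.succ 0))
    (r := x (Fin.succ (Fin.succ 0))) (hx.ne ((Fin.succ_ne_zero _).symm))
    (hx.ne (Fin.succ_ne_zero _)) (hx.ne ((Fin.succ_injective _).ne (Fin.succ_ne_zero _)))
  exact ⟨_, Fin.cases h0 (Fin.cases h1 (Fin.cases h2 fun _ => rfl))⟩

/-- The quotient of the space of configurations of `m + 3` points of the projective line, as the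
space of configurations of `m` points that avoid `(1 : 0)`, `(0 : 1)`, `(1 : 1)`. -/
noncomputable def configurationQuotientHomeomorph (m : ℕ) :
    (Quot fun x y : {x : Fin (m + 3) → ℙ ℂ (Fin 2 → ℂ) // Function.Injective x} =>
        ∃ g : GL (Fin 2) ℂ, ∀ i, glSMul g (x.1 i) = y.1 i) ≃ₜ
      {y : Fin m → ℙ ℂ (Fin 2 → ℂ) // Function.Injective y ∧
        ∀ i, y i ∉ ({pt 1 0 (Or.inl one_ne_zero), pt 0 1 (Or.inr one_ne_zero),
          pt 1 1 (Or.inl one_ne_zero)} : Set (ℙ ℂ (Fin 2 → ℂ)))} where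
  toFun := Quot.lift
    (fun x => ⟨normalizeConfiguration x.1 x.2, normalizeConfiguration_injective x.2,
      normalizeConfiguration_notMem x.2⟩)
    fun x y ⟨_, hg⟩ => Subtype.ext (normalizeConfiguration_eq_of_glSMul x.2 y.2 hg)
  invFun y := Quot.mk _ ⟨standardExtend y.1, standardExtend_injective y.2.1 y.2.2⟩
  left_inv := Quot.ind fun x => (Quot.sound (exists_glSMul_eq_standardExtend x.2)).symm
  right_inv y := Subtype.ext (normalizeConfiguration_standardExtend y.1
    (standardExtend_injective y.2.1 y.2.2))
  continuous_toFun := continuous_quot_lift _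
    ((continuous_normalizeConfiguration m).subtype_mk _)
  continuous_invFun := continuous_quot_mk.comp
    (((continuous_standardExtend m).comp continuous_subtype_val).subtype_mk _)

/-- For `n ≥ 3`, the quotient of the configuration space
`𝒲 = {x : Fin n → ℂP¹ | x injective}` by the (orbit equivalence relation of the) action of
`GL(2, ℂ)` is homeomorphic to the subspace of `(ℂP¹)^{n-3}` consisting of injective tuples
avoiding the three points `(1:0)`, `(0:1)` and `(1:1)`. -/
theorem configurationSpace_quotient_homeomorph (n : ℕ) (hn : 3 ≤ n) :
    Nonempty
      ((Quot fun x y : {x : Fin n → ℙ ℂ (Fin 2 → ℂ) // Function.Injective x} =>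
          ∃ g : GL (Fin 2) ℂ, ∀ i, glSMul g (x.1 i) = y.1 i) ≃ₜ
        {y : Fin (n - 3) → ℙ ℂ (Fin 2 → ℂ) // Function.Injective y ∧
          ∀ i, y i ∉ ({pt 1 0 (Or.inl one_ne_zero), pt 0 1 (Or.inr one_ne_zero),
            pt 1 1 (Or.inl one_ne_zero)} : Set (ℙ ℂ (Fin 2 → ℂ)))}) := by
  obtain ⟨m, rfl⟩ := Nat.exists_eq_add_of_le' hn
  exact ⟨configurationQuotientHomeomorph m⟩
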